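/- Let I be an open interval, n a positive integer, f, g ∈ C^{n+2}(I) with g^{(n+1)} never zero on I and φ = f^{(n+1)}/g^{(n+1)} satisfying φ' never zero on I. Let m₂ < m₁ be nonnegative integers with n = m₁+m₂+1, let a < b in I, and let x ∈ (a,b). Let ζ_P ∈ I be the unique point with f[x, a^{m₁+1}, b^{m₂+1}]/g[x, a^{m₁+1}, b^{m₂+1}] = f^{(n+1)}(ζ_P)/g^{(n+1)}(ζ_P) and ζ_Q ∈ I the unique point with f[x, a^{m₂+1}, b^{m₁+1}]/g[x, a^{m₂+1}, b^{m₁+1}] = f^{(n+1)}(ζ_Q)/g^{(n+1)}(ζ_Q). Then ζ_P < ζ_Q. -/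

import Mathlib

/-- `IsDD f x y z r s D` says that `D` is the value of the confluent divided difference
`f[x, y^r, z^s]` (node `y` repeated `r` times, node `z` repeated `s` times), characterized as
the leading coefficient of the Hermite interpolant of degree at most `r + s` matching `f` at
`x` and matching `f` and its derivatives up to order `r - 1` at `y` and `s - 1` at `z`. -/
def IsDD (f : ℝ → ℝ) (x y z : ℝ) (r s : ℕ) (D : ℝ) : Prop :=
  ∃ H : Polynomial ℝ, H.natDegree ≤ r + s ∧ H.coeff (r + s) = D ∧
    H.eval x = f x ∧
    (∀ j < r, iteratedDeriv j (fun t => H.eval t) y = iteratedDeriv j f y) ∧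
    (∀ j < s, iteratedDeriv j (fun t => H.eval t) z = iteratedDeriv j f z)

open Polynomial Set

/-! ### Zeros with multiplicity and Rolle's theorem

A chain `U 0, U 1, …` of successive derivatives is counted to vanish along a nondecreasing tuple
`z 0 ≤ … ≤ z m`, a point repeated `r` times standing for a zero of order `r`. -/

/-- The nondecreasing points `z 0, …, z m` are zeros of `U 0`, counted with multiplicity, where
`U r` plays the role of the `r`-th derivative. -/
def VanishesAlong (U : ℕ → ℝ → ℝ) (z : ℕ → ℝ) (m : ℕ) : Prop :=
  (∀ i j, i ≤ j → j ≤ m → z i ≤ z j) ∧ ∀ i r, i + r ≤ m → z i = z (i + r) → U r (z i) = 0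

/-- `U 0, …, U m` are successive derivatives on `J`. -/
def IsDerivChain (U : ℕ → ℝ → ℝ) (J : Set ℝ) (m : ℕ) : Prop :=
  ∀ j < m, ∀ t ∈ J, HasDerivAt (U j) (U (j + 1) t) t

lemma IsDerivChain.shift {U : ℕ → ℝ → ℝ} {J : Set ℝ} {m : ℕ} (hU : IsDerivChain U J (m + 1)) :
    IsDerivChain (fun j => U (j + 1)) J m :=
  fun j hj t ht => hU (j + 1) (by omega) t ht

/-- Rolle's theorem with multiplicities. -/
lemma VanishesAlong.rolle {U : ℕ → ℝ → ℝ} {z : ℕ → ℝ} {m : ℕ} {J : Set ℝ} (hJ : J.OrdConnected)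
    (hU : IsDerivChain U J (m + 1)) (hz : VanishesAlong U z (m + 1))
    (hzJ : ∀ i ≤ m + 1, z i ∈ J) :
    ∃ w : ℕ → ℝ, VanishesAlong (fun j => U (j + 1)) w m ∧ (∀ i ≤ m, w i ∈ J) ∧
      ∀ i ≤ m, w i ≤ z (i + 1) ∧ (z i < z (i + 1) → w i < z (i + 1)) := by
  obtain ⟨hmono, hzero⟩ := hz
  have key : ∀ i, ∃ w, i ≤ m → z i ≤ w ∧ w ≤ z (i + 1) ∧
      (z i < z (i + 1) → z i < w ∧ w < z (i + 1) ∧ U 1 w = 0) := by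
    intro i
    by_cases him : i ≤ m
    swap
    · exact ⟨0, fun h => absurd h him⟩
    rcases (hmono i (i + 1) (by omega) (by omega)).eq_or_lt with h | h
    · exact ⟨z i, fun _ => ⟨le_rfl, h.le, fun h' => absurd h h'.ne⟩⟩
    · have hsub : Icc (z i) (z (i + 1)) ⊆ J := hJ.out (hzJ i (by omega)) (hzJ _ (by omega))
      have h0 : U 0 (z i) = U 0 (z (i + 1)) := by
        rw [hzero i 0 (by omega) rfl, hzero (i + 1) 0 (by omega) rfl]
      obtain ⟨c, hc, hc0⟩ := exists_hasDerivAt_eq_zero h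
        (fun t ht => (hU 0 (by omega) t (hsub ht)).continuousAt.continuousWithinAt) h0
        (fun t ht => hU 0 (by omega) t (hsub (Ioo_subset_Icc_self ht)))
      exact ⟨c, fun _ => ⟨hc.1.le, hc.2.le, fun _ => ⟨hc.1, hc.2, hc0⟩⟩⟩
  choose w hw using key
  refine ⟨w, ⟨?_, ?_⟩, ?_, ?_⟩
  · intro i j hij hjm
    rcases hij.eq_or_lt with rfl | hlt
    · exact le_rfl
    · exact (hw i (by omega)).2.1.trans
        ((hmono (i + 1) j (by omega) (by omega)).trans (hw j hjm).1)
  · intro i r hir hwr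
    obtain ⟨h1, h2, h3⟩ := hw i (by omega)
    rcases (hmono i (i + 1) (by omega) (by omega)).eq_or_lt with h | h
    · have hwi : w i = z i := le_antisymm (h2.trans h.ge) h1
      suffices hh : z i = z (i + (r + 1)) by
        simpa [hwi] using hzero i (r + 1) (by omega) hh
      rcases (hmono (i + r) (i + r + 1) (by omega) (by omega)).eq_or_lt with h' | h'
      · refine le_antisymm (hmono _ _ (by omega) (by omega)) ?_
        calc z (i + (r + 1)) = z (i + r) := h'.symm
          _ ≤ w (i + r) := (hw (i + r) (by omega)).1
          _ = z i := by rw [← hwr, hwi]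
      · have := ((hw (i + r) (by omega)).2.2 h').1
        have := hmono i (i + r) (by omega) (by omega)
        linarith
    · obtain ⟨h4, h5, h6⟩ := h3 h
      rcases Nat.eq_zero_or_pos r with rfl | hr
      · exact h6
      · have := hmono (i + 1) (i + r) (by omega) (by omega)
        have := (hw (i + r) (by omega)).1
        linarith
  · intro i hi
    exact hJ.out (hzJ i (by omega)) (hzJ (i + 1) (by omega)) ⟨(hw i hi).1, (hw i hi).2.1⟩
  · exact fun i hi => ⟨(hw i hi).2.1, fun h => ((hw i hi).2.2 h).2.1⟩

lemma VanishesAlong.exists_eq_zero {m : ℕ} : ∀ {U : ℕ → ℝ → ℝ} {z : ℕ → ℝ} {J : Set ℝ},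
    J.OrdConnected → IsDerivChain U J m → VanishesAlong U z m → (∀ i ≤ m, z i ∈ J) →
    ∃ t ∈ J, U m t = 0 := by
  induction m with
  | zero =>
    intro U z J _ _ hz hzJ
    exact ⟨z 0, hzJ 0 le_rfl, hz.2 0 0 le_rfl rfl⟩
  | succ m ih =>
    intro U z J hJ hU hz hzJ
    obtain ⟨w, hw, hwJ, -⟩ := hz.rolle hJ hU hzJ
    exact ih hJ hU.shift hw hwJ

/-- If the last derivative changes sign at most once, from negative to positive, then a function
with the maximal number of zeros is positive beyond the last one. -/
lemma VanishesAlong.pos {m : ℕ} : ∀ {U : ℕ → ℝ → ℝ} {z : ℕ → ℝ} {J : Set ℝ},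
    J.OrdConnected → IsDerivChain U J m → VanishesAlong U z m → (∀ i ≤ m, z i ∈ J) →
    (∀ s ∈ J, ∀ t ∈ J, s < t → U m s = 0 → 0 < U m t) → ∀ t ∈ J, z m < t → 0 < U 0 t := by
  induction m with
  | zero =>
    intro U z J _ _ hz hzJ hs t ht hzt
    exact hs _ (hzJ 0 le_rfl) t ht hzt (hz.2 0 0 le_rfl rfl)
  | succ m ih =>
    intro U z J hJ hU hz hzJ hs t ht hzt
    obtain ⟨w, hw, hwJ, hwz⟩ := hz.rolle hJ hU hzJ
    have hpos := ih hJ hU.shift hw hwJ hs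
    have hsub : Icc (z (m + 1)) t ⊆ J := hJ.out (hzJ _ le_rfl) ht
    have hmono : StrictMonoOn (U 0) (Icc (z (m + 1)) t) := by
      refine strictMonoOn_of_deriv_pos (convex_Icc _ _)
        (fun s hs' => (hU 0 (by omega) s (hsub hs')).continuousAt.continuousWithinAt) ?_
      intro s hs'
      rw [interior_Icc] at hs'
      have hsJ := hsub (Ioo_subset_Icc_self hs')
      rw [(hU 0 (by omega) s hsJ).deriv]
      exact hpos s hsJ ((hwz m le_rfl).1.trans_lt hs'.1)
    have := hmono (left_mem_Icc.2 hzt.le) (right_mem_Icc.2 hzt.le) hzt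
    rwa [hz.2 (m + 1) 0 le_rfl rfl] at this

/-- Under the sign condition of `VanishesAlong.pos`, if at most `l` of the zeros sit at an upper
bound `t` of all of them, the `l`-th derivative is positive at `t`. -/
lemma VanishesAlong.pos_of_le {l : ℕ} : ∀ {m : ℕ} {U : ℕ → ℝ → ℝ} {z : ℕ → ℝ} {J : Set ℝ},
    J.OrdConnected → IsDerivChain U J m → VanishesAlong U z m → (∀ i ≤ m, z i ∈ J) →
    (∀ s ∈ J, ∀ t ∈ J, s < t → U m s = 0 → 0 < U m t) → ∀ t ∈ J, l ≤ m → (∀ i ≤ m, z i ≤ t) →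
    (∀ i, i + l ≤ m → z i < t) → 0 < U l t := by
  induction l with
  | zero =>
    intro m U z J hJ hU hz hzJ hs t ht _ _ hlt
    exact hz.pos hJ hU hzJ hs t ht (hlt m le_rfl)
  | succ l ih =>
    intro m U z J hJ hU hz hzJ hs t ht hlm hle hlt
    obtain ⟨m, rfl⟩ : ∃ m', m = m' + 1 := ⟨m - 1, by omega⟩
    obtain ⟨w, hw, hwJ, hwz⟩ := hz.rolle hJ hU hzJ
    refine ih hJ hU.shift hw hwJ hs t ht (by omega)
      (fun i hi => (hwz i hi).1.trans (hle _ (by omega))) (fun i hi => ?_)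
    rcases (hz.1 i (i + 1) (by omega) (by omega)).eq_or_lt with h | h
    · exact (hwz i (by omega)).1.trans_lt (h ▸ hlt i (by omega))
    · exact ((hwz i (by omega)).2 h).trans_le (hle _ (by omega))

/-! ### Nodes of a two-point Hermite problem with one extra simple node -/

/-- The nodes `a` (`r` times), `x` (once), then `b`. -/
noncomputable def hermiteNodes (x a b : ℝ) (r : ℕ) (i : ℕ) : ℝ :=
  if i < r then a else if i = r then x else b

lemma hermiteNodes_mem {x a b : ℝ} (hx : x ∈ Ioo a b) (r i : ℕ) :
    hermiteNodes x a b r i ∈ Icc a b := by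
  have := hx.1
  have := hx.2
  unfold hermiteNodes
  split_ifs <;> constructor <;> linarith

lemma hermiteNodes_lt {x a b : ℝ} (hx : x ∈ Ioo a b) {r i : ℕ} (hi : i ≤ r) :
    hermiteNodes x a b r i < b := by
  have := hx.1
  have := hx.2
  unfold hermiteNodes
  split_ifs
  · linarith
  · linarith
  · omega

lemma vanishesAlong_hermiteNodes {U : ℕ → ℝ → ℝ} {x a b : ℝ} (hx : x ∈ Ioo a b) {r s : ℕ}
    (hUx : U 0 x = 0) (hUa : ∀ j < r, U j a = 0) (hUb : ∀ j < s, U j b = 0) :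
    VanishesAlong U (hermiteNodes x a b r) (r + s) := by
  have hax := hx.1
  have hxb := hx.2
  unfold hermiteNodes
  constructor
  · intro i j hij _
    dsimp only
    split_ifs <;> first | omega | linarith
  · intro i q hiq h
    dsimp only at h ⊢
    split_ifs at h ⊢ <;> first
      | omega
      | linarith
      | exact hUa q (by omega)
      | exact hUb q (by omega)
      | (obtain rfl : q = 0 := by omega
         exact hUx)

/-! ### Polynomials -/

lemma Polynomial.iteratedDeriv_eval (p : ℝ[X]) (j : ℕ) :
    iteratedDeriv j (fun t => p.eval t) = fun t => (derivative^[j] p).eval t := by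
  induction j with
  | zero => simp
  | succ j ih =>
    rw [iteratedDeriv_succ, ih]
    funext t
    rw [Function.iterate_succ_apply', Polynomial.deriv]

lemma Polynomial.iterate_derivative_eq_C {p : ℝ[X]} {N : ℕ} (hp : p.natDegree ≤ N) :
    derivative^[N] p = C (N.factorial * p.coeff N) := by
  have h := natDegree_iterate_derivative p N
  rw [eq_C_of_natDegree_le_zero (p := derivative^[N] p) (by omega), coeff_iterate_derivative]
  simp [Nat.descFactorial_self]

lemma Polynomial.eval_iterate_derivative_eq_zero_of_dvd {p : ℝ[X]} {y : ℝ} {r j : ℕ}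
    (hj : j < r) (h : (X - C y) ^ r ∣ p) : (derivative^[j] p).eval y = 0 := by
  have h1 := pow_sub_dvd_iterate_derivative_of_pow_dvd j h
  exact dvd_iff_isRoot.1 ((dvd_pow_self _ (by omega)).trans h1)

lemma Polynomial.pow_dvd_of_eval_iterate_derivative {p : ℝ[X]} {y : ℝ} {r : ℕ}
    (h : ∀ j < r, (derivative^[j] p).eval y = 0) : (X - C y) ^ r ∣ p := by
  rcases eq_or_ne p 0 with rfl | hp
  · exact dvd_zero _
  rcases r with _ | r
  · simp
  rw [← le_rootMultiplicity_iff hp]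
  exact (lt_rootMultiplicity_iff_isRoot_iterate_derivative hp).2 fun j hj => h j (by omega)

lemma Polynomial.eval_iterate_derivative_pow_mul (q : ℝ[X]) (y : ℝ) (r : ℕ) :
    (derivative^[r] ((X - C y) ^ r * q)).eval y = r.factorial * q.eval y := by
  rw [iterate_derivative_mul, eval_finsetSum, Finset.sum_eq_single_of_mem 0 (by simp)]
  · simp [iterate_derivative_X_sub_pow_self]
  · intro k hk hk0
    have hkr : r - k < r := by
      have := Finset.mem_range.1 hk
      omega
    simp [eval_iterate_derivative_eq_zero_of_dvd hkr dvd_rfl]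

/-- A polynomial of degree at most `r + s + 1` vanishing at `x`, to order `r` at `a` and to order
`s` at `b` is a multiple of the nodal polynomial. -/
lemma Polynomial.eval_iterate_derivative_of_vanishing {p : ℝ[X]} {x a b : ℝ} {r s : ℕ}
    (hxa : x ≠ a) (hxb : x ≠ b) (hab : a ≠ b) (hp : p.natDegree ≤ r + s + 1)
    (hpx : p.eval x = 0) (hpa : ∀ j < r, (derivative^[j] p).eval a = 0)
    (hpb : ∀ j < s, (derivative^[j] p).eval b = 0) :
    (derivative^[s] p).eval b =
      p.coeff (r + s + 1) * (s.factorial * ((b - x) * (b - a) ^ r)) := by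
  have hcop : ∀ {u v : ℝ}, u ≠ v → IsCoprime (X - C u) (X - C v) := fun h =>
    isCoprime_X_sub_C_of_isUnit_sub (sub_ne_zero.2 h).isUnit
  have hdvd : (X - C b) ^ s * ((X - C x) * (X - C a) ^ r) ∣ p := by
    refine IsCoprime.mul_dvd ?_ (pow_dvd_of_eval_iterate_derivative hpb)
      (IsCoprime.mul_dvd ((hcop hxa).pow_right) (dvd_iff_isRoot.2 hpx)
        (pow_dvd_of_eval_iterate_derivative hpa))
    exact IsCoprime.mul_right (hcop hxb.symm).pow_left (hcop hab.symm).pow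
  obtain ⟨q, rfl⟩ := hdvd
  rcases eq_or_ne q 0 with rfl | hq
  · simp
  have hmonic : ((X - C b) ^ s * ((X - C x) * (X - C a) ^ r)).Monic :=
    ((monic_X_sub_C b).pow s).mul ((monic_X_sub_C x).mul ((monic_X_sub_C a).pow r))
  have hdeg : ((X - C b) ^ s * ((X - C x) * (X - C a) ^ r)).natDegree = r + s + 1 := by
    rw [((monic_X_sub_C b).pow s).natDegree_mul ((monic_X_sub_C x).mul ((monic_X_sub_C a).pow r)),
      (monic_X_sub_C x).natDegree_mul ((monic_X_sub_C a).pow r)]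
    simp
    omega
  rw [hmonic.natDegree_mul' hq, hdeg] at hp
  obtain ⟨c, rfl⟩ : ∃ c, q = C c := ⟨_, eq_C_of_natDegree_le_zero (by omega)⟩
  have hlead : ((X - C b) ^ s * ((X - C x) * (X - C a) ^ r)).coeff (r + s + 1) = 1 := by
    rw [← hdeg]
    exact hmonic
  rw [coeff_mul_C, hlead, mul_assoc, eval_iterate_derivative_pow_mul]
  simp
  ring

/-! ### Divided differences -/

lemma IsDD.symm {f : ℝ → ℝ} {x y z : ℝ} {r s : ℕ} {D : ℝ} (h : IsDD f x y z r s D) :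
    IsDD f x z y s r D := by
  obtain ⟨H, h1, h2, h3, h4, h5⟩ := h
  exact ⟨H, by omega, by rwa [add_comm], h3, h5, h4⟩

lemma IsDD.neg {f : ℝ → ℝ} {x y z : ℝ} {r s : ℕ} {D : ℝ} (h : IsDD f x y z r s D) :
    IsDD (-f) x y z r s (-D) := by
  obtain ⟨H, h1, h2, h3, h4, h5⟩ := h
  simp only [iteratedDeriv_eval] at h4 h5
  refine ⟨-H, by simpa using h1, by simp [h2], by simp [h3], fun j hj => ?_, fun j hj => ?_⟩
  · simp [iteratedDeriv_eval, iteratedDeriv_neg, ← h4 j hj]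
  · simp [iteratedDeriv_eval, iteratedDeriv_neg, ← h5 j hj]

lemma exists_isDD_succ_right {f : ℝ → ℝ} {x y z : ℝ} {r s : ℕ} (hzx : z ≠ x) (hzy : z ≠ y)
    (h : ∃ D, IsDD f x y z r s D) : ∃ D, IsDD f x y z r (s + 1) D := by
  obtain ⟨-, H, h1, -, h3, h4, h5⟩ := h
  simp only [iteratedDeriv_eval] at h4 h5
  set w : ℝ[X] := (X - C x) * (X - C y) ^ r with hw
  have hwz : w.eval z ≠ 0 := by
    simp [hw, sub_ne_zero, hzx, hzy]
  have hs : (s.factorial : ℝ) ≠ 0 := by positivity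
  set c : ℝ := (iteratedDeriv s f z - (derivative^[s] H).eval z) / (s.factorial * w.eval z) with hc
  have hdeg : (C c * ((X - C z) ^ s * w)).natDegree ≤ r + (s + 1) := by
    have e1 : ((X - C z) ^ s).natDegree = s := by simp
    have e2 : ((X - C y) ^ r).natDegree = r := by simp
    have e3 : (X - C x).natDegree = 1 := by simp
    have e4 := natDegree_mul_le (p := (X - C z) ^ s) (q := w)
    have e5 := natDegree_mul_le (p := X - C x) (q := (X - C y) ^ r)
    have e6 := natDegree_C_mul_le c ((X - C z) ^ s * w)
    rw [← hw] at e5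
    omega
  have hder : ∀ (j : ℕ) (t : ℝ), (derivative^[j] (H + C c * ((X - C z) ^ s * w))).eval t =
      (derivative^[j] H).eval t + c * (derivative^[j] ((X - C z) ^ s * w)).eval t := fun j t => by
    rw [iterate_map_add, iterate_derivative_C_mul, eval_add, eval_mul, eval_C]
  refine ⟨_, H + C c * ((X - C z) ^ s * w), ?_, rfl, ?_, fun j hj => ?_, fun j hj => ?_⟩
  · exact (natDegree_add_le _ _).trans (max_le (by omega) hdeg)
  · simp [h3, hw]
  · have hd : (X - C y) ^ r ∣ (X - C z) ^ s * w := (dvd_mul_left _ (X - C x)).mul_left _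
    rw [iteratedDeriv_eval]
    dsimp only
    rw [hder, eval_iterate_derivative_eq_zero_of_dvd hj hd, h4 j hj, mul_zero, add_zero]
  · rw [iteratedDeriv_eval]
    dsimp only
    rw [hder]
    rcases Nat.lt_succ_iff_lt_or_eq.1 hj with hj | rfl
    · rw [eval_iterate_derivative_eq_zero_of_dvd hj (dvd_mul_right _ w), h5 j hj, mul_zero,
        add_zero]
    · rw [eval_iterate_derivative_pow_mul, hc]
      field_simp
      ring

lemma exists_isDD (f : ℝ → ℝ) {x y z : ℝ} (hyx : y ≠ x) (hzx : z ≠ x) (hzy : z ≠ y) (r s : ℕ) :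
    ∃ D, IsDD f x y z r s D := by
  induction s with
  | zero =>
    induction r with
    | zero => exact ⟨_, C (f x), by simp, rfl, by simp, by simp, by simp⟩
    | succ r ih =>
      obtain ⟨D, hD⟩ := ih
      obtain ⟨D', hD'⟩ := exists_isDD_succ_right hyx hzy.symm ⟨D, hD.symm⟩
      exact ⟨D', hD'.symm⟩
  | succ s ih => exact exists_isDD_succ_right hzx hzy ih

lemma isDerivChain_eval (p : ℝ[X]) (J : Set ℝ) (m : ℕ) :
    IsDerivChain (fun j t => (derivative^[j] p).eval t) J m := by
  intro j _ t _
  simp only [Function.iterate_succ_apply']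
  exact Polynomial.hasDerivAt _ _

/-- The mean value theorem for divided differences. -/
lemma IsDD.exists_iteratedDeriv_eq {f : ℝ → ℝ} {x a b : ℝ} {r s : ℕ} {D : ℝ} {I : Set ℝ}
    (hI : I.OrdConnected) (ha : a ∈ I) (hb : b ∈ I) (hx : x ∈ Ioo a b)
    (hf : IsDerivChain (fun j => iteratedDeriv j f) I (r + s)) (h : IsDD f x a b r s D) :
    ∃ t ∈ I, iteratedDeriv (r + s) f t = (r + s).factorial * D := by
  obtain ⟨H, h1, h2, h3, h4, h5⟩ := h
  simp only [iteratedDeriv_eval] at h4 h5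
  have hU : IsDerivChain (fun j t => iteratedDeriv j f t - (derivative^[j] H).eval t) I (r + s) :=
    fun j hj t ht => (hf j hj t ht).sub (isDerivChain_eval H I _ j hj t ht)
  obtain ⟨t, ht, h0⟩ := (vanishesAlong_hermiteNodes hx (by simp [h3])
    (fun j hj => by simp [h4 j hj]) (fun j hj => by simp [h5 j hj])).exists_eq_zero hI hU
    (fun i _ => hI.out ha hb (hermiteNodes_mem hx r i))
  refine ⟨t, ht, ?_⟩
  rw [iterate_derivative_eq_C h1, h2, eval_C] at h0
  linarith

lemma IsDD.pos {g : ℝ → ℝ} {x a b : ℝ} {r s : ℕ} {D : ℝ} {I : Set ℝ}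
    (hI : I.OrdConnected) (ha : a ∈ I) (hb : b ∈ I) (hx : x ∈ Ioo a b)
    (hg : IsDerivChain (fun j => iteratedDeriv j g) I (r + s))
    (hpos : ∀ t ∈ I, 0 < iteratedDeriv (r + s) g t) (h : IsDD g x a b r s D) : 0 < D := by
  obtain ⟨t, ht, h'⟩ := h.exists_iteratedDeriv_eq hI ha hb hx hg
  have := hpos t ht
  rw [h'] at this
  exact pos_of_mul_pos_right this (by positivity)

/-- Replacing one node `a` by `b` increases the quotient of divided differences. -/
lemma IsDD.div_lt_div_succ {f g : ℝ → ℝ} {x a b : ℝ} {r s N : ℕ} {D D' E E' : ℝ} {I : Set ℝ}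
    (hI : I.OrdConnected) (ha : a ∈ I) (hb : b ∈ I) (hx : x ∈ Ioo a b) (hN : N = r + s + 1)
    (hf : IsDerivChain (fun j => iteratedDeriv j f) I N)
    (hg : IsDerivChain (fun j => iteratedDeriv j g) I N)
    (hpos : ∀ t ∈ I, 0 < iteratedDeriv N g t)
    (hmono : StrictMonoOn (fun t => iteratedDeriv N f t / iteratedDeriv N g t) I)
    (hD : IsDD f x a b (r + 1) s D) (hD' : IsDD f x a b r (s + 1) D')
    (hE : IsDD g x a b (r + 1) s E) (hE' : IsDD g x a b r (s + 1) E') :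
    D / E < D' / E' := by
  have hax := hx.1
  have hxb := hx.2
  have hN1 : N = r + 1 + s := by omega
  have hE0 : 0 < E := hE.pos hI ha hb hx (hN1 ▸ hg) (hN1 ▸ hpos)
  have hE'0 : 0 < E' := hE'.pos hI ha hb hx (hN ▸ hg) (hN ▸ hpos)
  obtain ⟨P, hP1, hP2, hP3, hP4, hP5⟩ := hD
  obtain ⟨Q, hQ1, hQ2, hQ3, hQ4, hQ5⟩ := hE
  obtain ⟨P', hP1', hP2', hP3', hP4', hP5'⟩ := hD'
  obtain ⟨Q', hQ1', hQ2', hQ3', hQ4', hQ5'⟩ := hE'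
  simp only [iteratedDeriv_eval] at hP4 hP5 hQ4 hQ5 hP4' hP5' hQ4' hQ5'
  set c := D / E with hc
  have hcE : D = c * E := by rw [hc]; field_simp
  rw [lt_div_iff₀ hE'0]
  have hKdeg : ∀ {A B : ℝ[X]}, A.natDegree ≤ N → B.natDegree ≤ N →
      (A - C c * B).natDegree ≤ N := fun {A B} hA hB =>
    (natDegree_sub_le _ _).trans (max_le hA ((natDegree_C_mul_le _ _).trans hB))
  have hKder : ∀ (A B : ℝ[X]) (j : ℕ) (t : ℝ), (derivative^[j] (A - C c * B)).eval t =
      (derivative^[j] A).eval t - c * (derivative^[j] B).eval t := fun A B j t => by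
    simp [iterate_derivative_C_mul]
  set K := P - C c * Q with hK
  set K' := P' - C c * Q' with hK'
  have hKN : K.natDegree ≤ N := hKdeg (by omega) (by omega)
  have hKN' : K'.natDegree ≤ N := hKdeg (by omega) (by omega)
  have hcoeff : K.coeff N = 0 := by
    simp [hK, hN1, hP2, hQ2, hcE]
  have hcoeff' : K'.coeff N = D' - c * E' := by
    have : N = r + (s + 1) := by omega
    simp [hK', this, hP2', hQ2']
  let U : ℕ → ℝ → ℝ := fun j t =>
    iteratedDeriv j f t - c * iteratedDeriv j g t - (derivative^[j] K).eval t
  have hU : IsDerivChain U I N := fun j hj t ht =>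
    ((hf j hj t ht).sub ((hg j hj t ht).const_mul c)).sub (isDerivChain_eval K I _ j hj t ht)
  have hUN : ∀ t ∈ I, U N t =
      iteratedDeriv N g t * (iteratedDeriv N f t / iteratedDeriv N g t - c) := by
    intro t ht
    have := (hpos t ht).ne'
    simp only [U, iterate_derivative_eq_C hKN, hcoeff]
    field_simp
    simp
  have hUvan : VanishesAlong U (hermiteNodes x a b (r + 1)) N := by
    rw [hN1]
    refine vanishesAlong_hermiteNodes hx ?_ (fun j hj => ?_) (fun j hj => ?_)
    · simp [U, hK, hP3, hQ3]
    · simp [U, hK, hP4 j hj, hQ4 j hj]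
    · simp [U, hK, hP5 j hj, hQ5 j hj]
  have hUpos : 0 < U s b := by
    refine hUvan.pos_of_le hI hU (fun i _ => hI.out ha hb (hermiteNodes_mem hx _ i)) ?_ b hb
      (by omega) (fun i _ => (hermiteNodes_mem hx _ i).2)
      (fun i hi => hermiteNodes_lt hx (by omega))
    intro u hu t ht hut hu0
    rw [hUN u hu] at hu0
    rw [hUN t ht]
    have h1 := (mul_eq_zero.1 hu0).resolve_left (hpos u hu).ne'
    have h2 := hmono hu ht hut
    dsimp only at h2
    exact mul_pos (hpos t ht) (by linarith)
  have hsub : ∀ (j : ℕ) (t : ℝ), (derivative^[j] (K' - K)).eval t =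
      (derivative^[j] K').eval t - (derivative^[j] K).eval t := fun j t => by
    simp
  have hval := eval_iterate_derivative_of_vanishing (p := K' - K) (x := x) (a := a) (b := b)
    (r := r) (s := s) hax.ne' hxb.ne (hax.trans hxb).ne
    (hN ▸ (natDegree_sub_le _ _).trans (max_le hKN' hKN))
    (by simp [hK, hK', hP3, hP3', hQ3, hQ3'])
    (fun j hj => by
      rw [hsub, hK, hK', hKder, hKder, hP4 j (by omega), hP4' j hj, hQ4 j (by omega), hQ4' j hj,
        sub_self])
    (fun j hj => by
      rw [hsub, hK, hK', hKder, hKder, hP5 j hj, hP5' j (by omega), hQ5 j hj, hQ5' j (by omega),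
        sub_self])
  rw [← hN, coeff_sub, hcoeff, hcoeff', sub_zero, hsub, hK', hKder, hP5' s (by omega),
    hQ5' s (by omega)] at hval
  change _ - _ - _ = _ at hval
  have hw : 0 < (s.factorial : ℝ) * ((b - x) * (b - a) ^ r) := by
    have h1 : 0 < b - x := by linarith
    have h2 : 0 < b - a := by linarith
    positivity
  have : 0 < (D' - c * E') * (s.factorial * ((b - x) * (b - a) ^ r)) := hval ▸ hUpos
  linarith [pos_of_mul_pos_left this hw.le]

/-- Moving nodes from `a` to `b` increases the quotient of divided differences. -/
lemma IsDD.div_lt_div {f g : ℝ → ℝ} {x a b : ℝ} {N : ℕ} {I : Set ℝ}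
    (hI : I.OrdConnected) (ha : a ∈ I) (hb : b ∈ I) (hx : x ∈ Ioo a b)
    (hf : IsDerivChain (fun j => iteratedDeriv j f) I N)
    (hg : IsDerivChain (fun j => iteratedDeriv j g) I N)
    (hpos : ∀ t ∈ I, 0 < iteratedDeriv N g t)
    (hmono : StrictMonoOn (fun t => iteratedDeriv N f t / iteratedDeriv N g t) I) (d : ℕ) :
    ∀ {r s : ℕ} {D D' E E' : ℝ}, N = r + s + d + 1 →
      IsDD f x a b (r + d + 1) s D → IsDD f x a b r (s + d + 1) D' →
      IsDD g x a b (r + d + 1) s E → IsDD g x a b r (s + d + 1) E' → D / E < D' / E' := by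
  induction d with
  | zero =>
    intro r s D D' E E' hN hD hD' hE hE'
    exact hD.div_lt_div_succ hI ha hb hx hN hf hg hpos hmono hD' hE hE'
  | succ d ih =>
    intro r s D D' E E' hN hD hD' hE hE'
    have hex : ∀ F : ℝ → ℝ, ∃ M, IsDD F x a b (r + d + 1) (s + 1) M := fun F =>
      exists_isDD F hx.1.ne hx.2.ne' (hx.1.trans hx.2).ne' _ _
    obtain ⟨M, hM⟩ := hex f
    obtain ⟨L, hL⟩ := hex g
    refine (hD.div_lt_div_succ (r := r + d + 1) hI ha hb hx (by omega) hf hg hpos hmono hM hE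
      hL).trans ?_
    have hs : s + (d + 1) + 1 = s + 1 + d + 1 := by omega
    rw [hs] at hD' hE'
    exact ih (by omega) hM hD' hL hE'

lemma ContDiffOn.isDerivChain_iteratedDeriv {f : ℝ → ℝ} {I : Set ℝ} (hI : IsOpen I) {N : ℕ}
    (hf : ContDiffOn ℝ N f I) : IsDerivChain (fun j => iteratedDeriv j f) I N := by
  intro j hj t ht
  have h1 : DifferentiableOn ℝ (iteratedDerivWithin j f I) I :=
    hf.differentiableOn_iteratedDerivWithin (by exact_mod_cast hj) hI.uniqueDiffOn
  have h2 : DifferentiableAt ℝ (iteratedDeriv j f) t :=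
    ((h1.congr fun u hu => (iteratedDerivWithin_of_isOpen hI hu).symm) t ht).differentiableAt
      (hI.mem_nhds ht)
  have h3 := h2.hasDerivAt
  rwa [← iteratedDeriv_succ] at h3

lemma IsDerivChain.neg {f : ℝ → ℝ} {I : Set ℝ} {N : ℕ}
    (hf : IsDerivChain (fun j => iteratedDeriv j f) I N) :
    IsDerivChain (fun j => iteratedDeriv j (-f)) I N := by
  intro j hj t ht
  have h : iteratedDeriv j (-f) = -iteratedDeriv j f := funext fun u => iteratedDeriv_neg j f u
  dsimp only
  rw [h, iteratedDeriv_neg]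
  exact (hf j hj t ht).neg

lemma forall_pos_or_forall_neg_of_continuousOn {h : ℝ → ℝ} {I : Set ℝ} (hI : I.OrdConnected)
    (hh : ContinuousOn h I) (h0 : ∀ t ∈ I, h t ≠ 0) :
    (∀ t ∈ I, 0 < h t) ∨ ∀ t ∈ I, h t < 0 := by
  by_contra! hcon
  obtain ⟨⟨u, hu, hu0⟩, v, hv, hv0⟩ := hcon
  obtain ⟨t, ht, ht0⟩ := hI.isPreconnected.intermediate_value hu hv hh ⟨hu0, hv0⟩
  exact h0 t ht ht0

lemma strictMonoOn_or_strictAntiOn_of_derivWithin_ne_zero {h : ℝ → ℝ} {I : Set ℝ}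
    (hI : I.OrdConnected) (h0 : ∀ t ∈ I, derivWithin h I t ≠ 0) :
    StrictMonoOn h I ∨ StrictAntiOn h I := by
  have hd : ∀ t ∈ I, HasDerivWithinAt h (derivWithin h I t) I t := fun t ht =>
    (differentiableWithinAt_of_derivWithin_ne_zero (h0 t ht)).hasDerivWithinAt
  have hc : ContinuousOn h I := fun t ht => (hd t ht).continuousWithinAt
  have hder : ∀ t ∈ interior I, deriv h t = derivWithin h I t := fun t ht =>
    (derivWithin_of_mem_nhds (mem_interior_iff_mem_nhds.1 ht)).symm
  rcases hasDerivWithinAt_forall_lt_or_forall_gt_of_forall_ne hI.convex hd h0 with hlt | hgt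
  · exact Or.inr (strictAntiOn_of_deriv_neg hI.convex hc fun t ht => by
      rw [hder t ht]; exact hlt t (interior_subset ht))
  · exact Or.inl (strictMonoOn_of_deriv_pos hI.convex hc fun t ht => by
      rw [hder t ht]; exact hgt t (interior_subset ht))

theorem stmt11 (m₁ m₂ : ℕ) (hm : m₂ < m₁) (n : ℕ) (hn : n = m₁ + m₂ + 1)
    (I : Set ℝ) (hIopen : IsOpen I) (hIconn : I.OrdConnected)
    (f g : ℝ → ℝ)
    (hf : ContDiffOn ℝ (n + 2 : ℕ) f I) (hg : ContDiffOn ℝ (n + 2 : ℕ) g I)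
    (hg' : ∀ x ∈ I, iteratedDerivWithin (n + 1) g I x ≠ 0)
    (hφ : ∀ x ∈ I, derivWithin
        (fun t => iteratedDerivWithin (n + 1) f I t / iteratedDerivWithin (n + 1) g I t) I x ≠ 0)
    (a b : ℝ) (haI : a ∈ I) (hbI : b ∈ I) (hab : a < b) (x : ℝ) (hx : x ∈ Set.Ioo a b)
    (DP DQ EP EQ : ℝ)
    (hDP : IsDD f x a b (m₁ + 1) (m₂ + 1) DP)
    (hDQ : IsDD f x a b (m₂ + 1) (m₁ + 1) DQ)
    (hEP : IsDD g x a b (m₁ + 1) (m₂ + 1) EP)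
    (hEQ : IsDD g x a b (m₂ + 1) (m₁ + 1) EQ)
    (ζP ζQ : ℝ) (hζP : ζP ∈ I) (hζQ : ζQ ∈ I)
    (hP : DP / EP = iteratedDerivWithin (n + 1) f I ζP / iteratedDerivWithin (n + 1) g I ζP)
    (hQ : DQ / EQ = iteratedDerivWithin (n + 1) f I ζQ / iteratedDerivWithin (n + 1) g I ζQ) :
    ζP < ζQ := by
  obtain ⟨d, rfl⟩ : ∃ d, m₁ = m₂ + d + 1 := ⟨m₁ - m₂ - 1, by omega⟩
  have heq : ∀ h : ℝ → ℝ, ∀ t ∈ I, iteratedDerivWithin (n + 1) h I t = iteratedDeriv (n + 1) h t :=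
    fun h t ht => iteratedDerivWithin_of_isOpen hIopen ht
  have hfc : IsDerivChain (fun j => iteratedDeriv j f) I (n + 1 + 1) :=
    hf.isDerivChain_iteratedDeriv hIopen
  have hgc : IsDerivChain (fun j => iteratedDeriv j g) I (n + 1 + 1) :=
    hg.isDerivChain_iteratedDeriv hIopen
  have hfN : IsDerivChain (fun j => iteratedDeriv j f) I (n + 1) := fun j hj => hfc j (by omega)
  have hgN : IsDerivChain (fun j => iteratedDeriv j g) I (n + 1) := fun j hj => hgc j (by omega)
  have hN : n + 1 = m₂ + 1 + (m₂ + 1) + d + 1 := by omega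
  have hr : m₂ + d + 1 + 1 = m₂ + 1 + d + 1 := by omega
  rw [hr] at hDP hDQ hEP hEQ
  rw [heq f _ hζP, heq g _ hζP] at hP
  rw [heq f _ hζQ, heq g _ hζQ] at hQ
  have hmono : StrictMonoOn (fun t => iteratedDeriv (n + 1) f t / iteratedDeriv (n + 1) g t) I ∨
      StrictAntiOn (fun t => iteratedDeriv (n + 1) f t / iteratedDeriv (n + 1) g t) I := by
    have hE : EqOn
        (fun t => iteratedDerivWithin (n + 1) f I t / iteratedDerivWithin (n + 1) g I t)
        (fun t => iteratedDeriv (n + 1) f t / iteratedDeriv (n + 1) g t) I := fun t ht => by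
      simp only [heq f t ht, heq g t ht]
    exact (strictMonoOn_or_strictAntiOn_of_derivWithin_ne_zero hIconn hφ).imp
      (fun h => h.congr hE) (fun h => h.congr hE)
  have hsign := forall_pos_or_forall_neg_of_continuousOn (h := iteratedDeriv (n + 1) g) hIconn
    (fun t ht => (hgc (n + 1) (by omega) t ht).continuousAt.continuousWithinAt)
    (fun t ht => heq g t ht ▸ hg' t ht)
  have hneg : ∀ h : ℝ → ℝ, iteratedDeriv (n + 1) (-h) = -iteratedDeriv (n + 1) h :=
    fun h => funext fun t => iteratedDeriv_neg _ _ _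
  rcases hmono with hmono | hmono
  · have hlt : DP / EP < DQ / EQ := by
      rcases hsign with hpos | hpos
      · exact IsDD.div_lt_div hIconn haI hbI hx hfN hgN hpos hmono d hN hDP hDQ hEP hEQ
      · have := IsDD.div_lt_div hIconn haI hbI hx hfN.neg hgN.neg
          (fun t ht => by simpa [hneg] using hpos t ht) (by simpa [hneg] using hmono) d hN
          hDP.neg hDQ.neg hEP.neg hEQ.neg
        simpa using this
    rw [hP, hQ] at hlt
    exact (hmono.lt_iff_lt hζP hζQ).1 hlt
  · have hlt : DQ / EQ < DP / EP := by
      rcases hsign with hpos | hpos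
      · have := IsDD.div_lt_div hIconn haI hbI hx hfN.neg hgN hpos
          (by simpa [hneg, neg_div] using hmono.neg) d hN hDP.neg hDQ.neg hEP hEQ
        simpa [neg_div] using this
      · have := IsDD.div_lt_div hIconn haI hbI hx hfN hgN.neg
          (fun t ht => by simpa [hneg] using hpos t ht)
          (by simpa [hneg, div_neg] using hmono.neg) d hN hDP hDQ hEP.neg hEQ.neg
        simpa [div_neg] using this
    rw [hP, hQ] at hlt
    exact (hmono.lt_iff_gt hζQ hζP).1 hlt
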